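/- arXiv:0811.0402 — 2 statements merged into one kernel-verified Lean document; each statement's English description precedes it below -/
import Mathlib

section
/- Let Γ be a connected primitively log divergent simple graph with exactly 10 edges. Then Γ is isomorphic as a simple graph to the graph on vertex set {1,…,6} determined by one of the following four symmetric 0–1 adjacency matrices (where vertices i and j are adjacent iff the (i,j) entry is 1): WS₅: rows (0,1,1,1,1,1),(1,0,1,0,0,1),(1,1,0,1,0,0),(1,0,1,0,1,0),(1,0,0,1,0,1),(1,1,0,0,1,0); ZZ₅: rows (0,1,1,1,1,0),(1,0,1,1,0,1),(1,1,0,0,0,1),(1,1,0,0,1,0),(1,0,0,1,0,1),(0,1,1,0,1,0); ST₅: rows (0,1,1,1,1,0),(1,0,1,1,1,0),(1,1,0,0,0,1),(1,1,0,0,0,1),(1,1,0,0,0,1),(0,0,1,1,1,0); XX₅: rows (0,0,1,1,1,1),(0,0,1,1,1,1),(1,1,0,1,0,0),(1,1,1,0,0,0),(1,1,0,0,0,1),(1,1,0,0,1,0). -/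
/-- The first Betti number `h₁(G) = |E(G)| − |V(G)| + c(G)` of a finite simple graph. -/
noncomputable def betti {V : Type*} (G : SimpleGraph V) : ℤ :=
  (Nat.card G.edgeSet : ℤ) - (Nat.card V : ℤ) + (Nat.card G.ConnectedComponent : ℤ)

/-- The set of endpoints of the edges in `F`. -/
def edgeSupport {V : Type*} (F : Set (Sym2 V)) : Set V := {v : V | ∃ e ∈ F, v ∈ e}

/-- The subgraph spanned by a set of edges `F`: its edge set is `F` and its vertex set
is the set of endpoints of edges in `F`. -/
def spannedSubgraph {V : Type*} (F : Set (Sym2 V)) : SimpleGraph (edgeSupport F) :=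
  (SimpleGraph.fromEdgeSet F).induce (edgeSupport F)

/-- `h₁(G_F) = |F| − |V(G_F)| + c(G_F)` for the subgraph spanned by `F`. -/
noncomputable def bettiOfEdges {V : Type*} (F : Set (Sym2 V)) : ℤ :=
  (Nat.card F : ℤ) - (Nat.card (edgeSupport F) : ℤ)
    + (Nat.card (spannedSubgraph F).ConnectedComponent : ℤ)

/-- The subgraph spanned by `F` is convergent: `|E| > 2·h₁`. -/
def ConvergentEdges {V : Type*} (F : Set (Sym2 V)) : Prop :=
  2 * bettiOfEdges F < (Nat.card F : ℤ)

/-- A graph is logarithmically divergent if `|E(G)| = 2·h₁(G)`. -/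
def LogDivergent {V : Type*} (G : SimpleGraph V) : Prop :=
  (Nat.card G.edgeSet : ℤ) = 2 * betti G

/-- A graph is primitively log divergent if it is logarithmically divergent and the
subgraph spanned by every nonempty proper subset of its edges which is connected is
convergent. -/
def PrimLogDivergent {V : Type*} (G : SimpleGraph V) : Prop :=
  LogDivergent G ∧
    ∀ F : Set (Sym2 V), F ⊆ G.edgeSet → F.Nonempty → F ≠ G.edgeSet →
      (spannedSubgraph F).Connected → ConvergentEdges F

/-- The simple graph on `Fin 6` whose adjacency is given by a symmetric 0–1 matrix
with zero diagonal: `i` and `j` are adjacent iff `A i j = 1` (and `i ≠ j`). -/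
def graphOfMatrix (A : Matrix (Fin 6) (Fin 6) ℕ) : SimpleGraph (Fin 6) :=
  SimpleGraph.fromRel (fun i j => A i j = 1)

def matWS5 : Matrix (Fin 6) (Fin 6) ℕ :=
  !![0,1,1,1,1,1;
     1,0,1,0,0,1;
     1,1,0,1,0,0;
     1,0,1,0,1,0;
     1,0,0,1,0,1;
     1,1,0,0,1,0]

def matZZ5 : Matrix (Fin 6) (Fin 6) ℕ :=
  !![0,1,1,1,1,0;
     1,0,1,1,0,1;
     1,1,0,0,0,1;
     1,1,0,0,1,0;
     1,0,0,1,0,1;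
     0,1,1,0,1,0]

def matST5 : Matrix (Fin 6) (Fin 6) ℕ :=
  !![0,1,1,1,1,0;
     1,0,1,1,1,0;
     1,1,0,0,0,1;
     1,1,0,0,0,1;
     1,1,0,0,0,1;
     0,0,1,1,1,0]

def matXX5 : Matrix (Fin 6) (Fin 6) ℕ :=
  !![0,0,1,1,1,1;
     0,0,1,1,1,1;
     1,1,0,1,0,0;
     1,1,1,0,0,0;
     1,1,0,0,0,1;
     1,1,0,0,1,0]

open Finset

/-- The symmetric Boolean matrix with zero diagonal and the given rows above the diagonal. -/
def symmBoolMatrix (a₁ a₂ a₃ a₄ a₅ b₂ b₃ b₄ b₅ c₃ c₄ c₅ d₄ d₅ e₅ : Bool) :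
    Fin 6 → Fin 6 → Bool :=
  ![![false, a₁, a₂, a₃, a₄, a₅],
    ![a₁, false, b₂, b₃, b₄, b₅],
    ![a₂, b₂, false, c₃, c₄, c₅],
    ![a₃, b₃, c₃, false, d₄, d₅],
    ![a₄, b₄, c₄, d₄, false, e₅],
    ![a₅, b₅, c₅, d₅, e₅, false]]

/-- Listing the rows and columns of `M` in the order `p`, some permutation of `Fin 6` that starts
with `0, 5` turns `A` into `M`, compared above the diagonal. The quantifiers are nested so that
deciding this prunes early. -/
abbrev IsRelabelling (A : Fin 6 → Fin 6 → Bool) (M : Matrix (Fin 6) (Fin 6) ℕ)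
    (p : Fin 6 → Fin 6) : Prop :=
  A 0 5 = decide (M (p 0) (p 1) = 1) ∧
  ∃ b, A 5 b = decide (M (p 1) (p 2) = 1) ∧ A 0 b = decide (M (p 0) (p 2) = 1) ∧
    (0 ≠ b ∧ 5 ≠ b) ∧
  ∃ c, A b c = decide (M (p 2) (p 3) = 1) ∧ A 5 c = decide (M (p 1) (p 3) = 1) ∧
    A 0 c = decide (M (p 0) (p 3) = 1) ∧ (0 ≠ c ∧ 5 ≠ c ∧ b ≠ c) ∧
  ∃ d, A c d = decide (M (p 3) (p 4) = 1) ∧ A b d = decide (M (p 2) (p 4) = 1) ∧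
    A 5 d = decide (M (p 1) (p 4) = 1) ∧ A 0 d = decide (M (p 0) (p 4) = 1) ∧
    (0 ≠ d ∧ 5 ≠ d ∧ b ≠ d ∧ c ≠ d) ∧
  ∃ e, A d e = decide (M (p 4) (p 5) = 1) ∧ A c e = decide (M (p 3) (p 5) = 1) ∧
    A b e = decide (M (p 2) (p 5) = 1) ∧ A 5 e = decide (M (p 1) (p 5) = 1) ∧
    A 0 e = decide (M (p 0) (p 5) = 1) ∧ (0 ≠ e ∧ 5 ≠ e ∧ b ≠ e ∧ c ≠ e ∧ d ≠ e)

set_option synthInstance.maxSize 4000 in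
set_option synthInstance.maxHeartbeats 400000 in
set_option maxRecDepth 4000 in
/-- Graphs on six labelled vertices with ten edges and minimum degree at least three, in which `0`
is adjacent to `1`, `2`, `3` and `4`. -/
theorem isRelabelling_of_three_le_rowSum :
    ∀ a₅ b₂ b₃ b₄ b₅ : Bool, 3 ≤ 1 + b₂.toNat + b₃.toNat + b₄.toNat + b₅.toNat →
    ∀ c₃ c₄ c₅ : Bool, 3 ≤ 1 + b₂.toNat + c₃.toNat + c₄.toNat + c₅.toNat →
    ∀ d₄ d₅ : Bool, 3 ≤ 1 + b₃.toNat + c₃.toNat + d₄.toNat + d₅.toNat →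
    ∀ e₅ : Bool, 3 ≤ 1 + b₄.toNat + c₄.toNat + d₄.toNat + e₅.toNat →
      3 ≤ a₅.toNat + b₅.toNat + c₅.toNat + d₅.toNat + e₅.toNat →
      4 + a₅.toNat + b₂.toNat + b₃.toNat + b₄.toNat + b₅.toNat + c₃.toNat + c₄.toNat +
        c₅.toNat + d₄.toNat + d₅.toNat + e₅.toNat = 10 →
      let A := symmBoolMatrix true true true true a₅ b₂ b₃ b₄ b₅ c₃ c₄ c₅ d₄ d₅ e₅
      IsRelabelling A matWS5 ![0, 1, 3, 5, 2, 4] ∨ IsRelabelling A matZZ5 ![0, 5, 3, 2, 4, 1] ∨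
      IsRelabelling A matST5 ![0, 5, 1, 2, 3, 4] ∨ IsRelabelling A matXX5 ![0, 1, 2, 4, 3, 5] := by
  decide +kernel

theorem nonempty_iso_of_isRelabelling {V : Type*} {G : SimpleGraph V} [DecidableRel G.Adj]
    (f : Fin 6 ≃ V) {M : Matrix (Fin 6) (Fin 6) ℕ} (hM : M.IsSymm) {p : Fin 6 → Fin 6}
    (hp : Function.Injective p) (h : IsRelabelling (fun i j => decide (G.Adj (f i) (f j))) M p) :
    Nonempty (G ≃g graphOfMatrix M) := by
  obtain ⟨h01, b, h12, h02, hb, c, h23, h13, h03, hc, d, h34, h24, h14, h04, hd, e, h45, h35,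
    h25, h15, h05, he⟩ := h
  simp only [decide_eq_decide] at *
  let s : Fin 6 → Fin 6 := ![0, 5, b, c, d, e]
  have hne : ∀ i j, i < j → s i ≠ s j := by
    intro i j hij
    obtain ⟨hb, hb'⟩ := hb
    obtain ⟨hc, hc', hc''⟩ := hc
    obtain ⟨hd, hd', hd'', hd₃⟩ := hd
    obtain ⟨he, he', he'', he₃, he₄⟩ := he
    fin_cases i <;> fin_cases j <;>
      first | exact absurd hij (by decide) | assumption | exact (by decide : (0 : Fin 6) ≠ 5)
  have hs : Function.Injective s := fun i j hij => by
    by_contra h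
    exact (Ne.lt_or_gt h).elim (fun h => hne i j h hij) (fun h => hne j i h hij.symm)
  have key : ∀ i j, i < j → (G.Adj (f (s i)) (f (s j)) ↔ M (p i) (p j) = 1) := by
    intro i j hij
    fin_cases i <;> fin_cases j <;> first | exact absurd hij (by decide) | assumption
  have key' : ∀ i j, G.Adj (f (s i)) (f (s j)) ↔ (graphOfMatrix M).Adj (p i) (p j) := by
    intro i j
    rw [graphOfMatrix, SimpleGraph.fromRel_adj, hM.apply (p i) (p j), or_self]
    rcases lt_trichotomy i j with hij | rfl | hij
    · simp [key i j hij, hp.ne hij.ne]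
    · simp
    · rw [G.adj_comm, key j i hij, hM.apply (p i) (p j)]
      simp [hp.ne hij.ne']
  let σ : Fin 6 ≃ Fin 6 := Equiv.ofBijective s hs.bijective_of_finite
  let π : Fin 6 ≃ Fin 6 := Equiv.ofBijective p hp.bijective_of_finite
  refine ⟨(RelIso.symm ⟨(π.symm.trans σ).trans f, fun {i j} => ?_⟩ : G ≃g graphOfMatrix M)⟩
  obtain ⟨i, rfl⟩ := π.surjective i
  obtain ⟨j, rfl⟩ := π.surjective j
  simp only [Equiv.trans_apply, Equiv.symm_apply_apply]
  exact key' i j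

theorem SimpleGraph.Connected.natCard_connectedComponent {V : Type*} {G : SimpleGraph V}
    (h : G.Connected) : Nat.card G.ConnectedComponent = 1 := by
  have := h.preconnected.subsingleton_connectedComponent
  have := h.nonempty
  exact Nat.card_eq_one_iff_unique.2 ⟨inferInstance, ⟨G.connectedComponentMk (Classical.arbitrary V)⟩⟩

/-- In a graph on six vertices with ten edges, two nonadjacent vertices have a common neighbour
other than a given vertex `v` of degree at most two. -/
theorem SimpleGraph.exists_common_neighbor_of_degree_le_two {V : Type*} [Fintype V]
    [DecidableEq V] {G : SimpleGraph V} [DecidableRel G.Adj] (hV : Fintype.card V = 6)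
    (hE : #G.edgeFinset = 10) {v a b : V} (hv : G.degree v ≤ 2) (hav : a ≠ v) (hbv : b ≠ v)
    (hab : a ≠ b) (hn : ¬ G.Adj a b) : ∃ c, c ≠ v ∧ G.Adj a c ∧ G.Adj b c := by
  by_contra! hc
  have h3 : #((univ : Finset V) \ {v, a, b}) = 3 := by
    rw [card_sdiff_of_subset (subset_univ _), card_univ, hV,
      card_eq_three.2 ⟨v, a, b, hav.symm, hbv.symm, hab, rfl⟩]
  obtain ⟨c, d, e, hcd, hce, hde, hu⟩ := card_eq_three.1 h3
  have hmem : ∀ x ∈ ({c, d, e} : Finset V), x ≠ v ∧ x ≠ a ∧ x ≠ b := fun x hx => by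
    rw [← hu] at hx; simpa using hx
  obtain ⟨hcv, hca, hcb⟩ := hmem c (by simp)
  obtain ⟨hdv, hda, hdb⟩ := hmem d (by simp)
  obtain ⟨hev, hea, heb⟩ := hmem e (by simp)
  have huniv : (univ : Finset V) = {v, a, b, c, d, e} := by
    ext x
    have : x ∈ (univ : Finset V) \ {v, a, b} ↔ x ∈ ({c, d, e} : Finset V) := by rw [hu]
    simp at this ⊢
    tauto
  have hsum (g : V → ℕ) : ∑ x, g x = g v + g a + g b + g c + g d + g e := by
    rw [huniv, sum_insert, sum_insert, sum_insert, sum_insert, sum_pair hde] <;>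
      simp [*, add_assoc, hav.symm, hbv.symm, hcv.symm, hdv.symm, hev.symm, hca.symm,
        hda.symm, hea.symm, hcb.symm, hdb.symm, heb.symm]
  have hdeg (x : V) : G.degree x = ∑ y, (if G.Adj x y then 1 else 0) := by
    rw [← card_filter, ← G.neighborFinset_eq_filter, G.card_neighborFinset_eq_degree]
  have htot := G.sum_degrees_eq_twice_card_edges
  have hle (x y : V) : (if G.Adj x y then 1 else 0) ≤ 1 := by split_ifs <;> simp
  have hsymm (x y : V) : (if G.Adj x y then 1 else 0) = if G.Adj y x then 1 else 0 := by
    simp only [G.adj_comm]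
  have hpair (x : V) (hx : x ≠ v) :
      (if G.Adj a x then 1 else 0) + (if G.Adj b x then 1 else 0) ≤ 1 := by
    have := hc x hx
    split_ifs <;> simp_all
  have hself (x : V) : (if G.Adj x x then 1 else 0) = 0 := by simp
  have hab0 : (if G.Adj a b then 1 else 0) = 0 := by simp [hn]
  have := hpair c hcv
  have := hpair d hdv
  have := hpair e hev
  have := hle c d
  have := hle c e
  have := hle d e
  rw [hE] at htot
  simp only [hsum, hdeg, hself, hsymm a v, hsymm b v, hsymm c v, hsymm d v, hsymm e v, hsymm b a,
    hsymm c a, hsymm d a, hsymm e a, hsymm c b, hsymm d b, hsymm e b, hsymm d c, hsymm e c,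
    hsymm e d, hab0] at htot hv
  omega

theorem PrimLogDivergent.three_le_degree {V : Type*} [Fintype V] {G : SimpleGraph V}
    [DecidableRel G.Adj] (hconn : G.Connected) (hpld : PrimLogDivergent G)
    (hV : Fintype.card V = 6) (hE : #G.edgeFinset = 10) (v : V) : 3 ≤ G.degree v := by
  classical
  by_contra! hv
  have : Nontrivial V := Fintype.one_lt_card_iff_nontrivial.1 (by omega)
  have hpos := hconn.preconnected.degree_pos_of_nontrivial v
  set F : Set (Sym2 V) := G.edgeSet \ G.incidenceSet v with hF
  have hE' : G.edgeSet.ncard = 10 := by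
    rw [← G.coe_edgeFinset, Set.ncard_coe_finset, hE]
  have hI : (G.incidenceSet v).ncard = G.degree v := by
    rw [← Nat.card_coe_set_eq, Nat.card_eq_fintype_card, G.card_incidenceSet_eq_degree]
  have hcard : Nat.card F = 10 - G.degree v := by
    rw [Nat.card_coe_set_eq, hF, Set.ncard_sdiff (G.incidenceSet_subset v), hE', hI]
  have hne : F.Nonempty := by
    rw [← Set.ncard_pos, ← Nat.card_coe_set_eq]; omega
  have hproper : F ≠ G.edgeSet := fun h => by
    rw [h, Nat.card_coe_set_eq, hE'] at hcard; omega
  have hmem {x y : V} (hx : x ≠ v) (hy : y ≠ v) (h : G.Adj x y) : s(x, y) ∈ F :=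
    ⟨h, fun h' => by
      rcases Sym2.mem_iff.1 h'.2 with rfl | rfl <;> contradiction⟩
  have hsupp : edgeSupport F ⊆ {v}ᶜ := by
    rintro x ⟨e, he, hx⟩ rfl
    exact he.2 ⟨he.1, hx⟩
  have hsuppcard : Nat.card (edgeSupport F) ≤ 5 := by
    rw [Nat.card_coe_set_eq]
    refine (Set.ncard_le_ncard hsupp).trans ?_
    rw [Set.ncard_compl, Nat.card_eq_fintype_card, hV, Set.ncard_singleton]
  have hadj {x y : edgeSupport F} (h : G.Adj x y) : (spannedSubgraph F).Adj x y :=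
    (SimpleGraph.fromEdgeSet_adj F).2 ⟨hmem (hsupp x.2) (hsupp y.2) h, h.ne⟩
  have hFconn : (spannedSubgraph F).Connected := by
    have : Nonempty (edgeSupport F) := by
      obtain ⟨e, he⟩ := hne
      induction e with | _ x y => exact ⟨x, s(x, y), he, Sym2.mem_mk_left x y⟩
    refine ⟨fun a b => ?_⟩
    by_cases hab : a = b
    · exact hab ▸ .rfl
    by_cases h : G.Adj a b
    · exact (hadj h).reachable
    obtain ⟨c, hcv, hac, hbc⟩ := SimpleGraph.exists_common_neighbor_of_degree_le_two hV hE
      (by omega) (hsupp a.2) (hsupp b.2) (Subtype.coe_ne_coe.2 hab) h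
    let c' : edgeSupport F := ⟨c, _, hmem (hsupp a.2) hcv hac, Sym2.mem_mk_right _ _⟩
    exact (hadj (y := c') hac).reachable.trans (hadj (y := c') hbc).reachable.symm
  have hconv := hpld.2 F Set.sdiff_subset hne hproper hFconn
  rw [ConvergentEdges, bettiOfEdges, hFconn.natCard_connectedComponent] at hconv
  omega

/-- In a graph on six vertices with a vertex of degree at least four, that vertex and its possible
non-neighbour can be labelled `0` and `5`. -/
theorem SimpleGraph.exists_equiv_adj_of_four_le_degree {V : Type*} [Fintype V]
    (G : SimpleGraph V) [DecidableRel G.Adj] (hV : Fintype.card V = 6) {v : V}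
    (hv : 4 ≤ G.degree v) :
    ∃ f : Fin 6 ≃ V, ∀ i, i ≠ 0 → i ≠ 5 → G.Adj (f 0) (f i) := by
  classical
  have hcard : #(Gᶜ.neighborFinset v) ≤ 1 := by
    have := G.degree_compl v
    rw [Gᶜ.card_neighborFinset_eq_degree]
    omega
  have : Nontrivial V := Fintype.one_lt_card_iff_nontrivial.1 (by omega)
  obtain ⟨w, hwv, hw⟩ : ∃ w, w ≠ v ∧ ∀ u, Gᶜ.Adj v u → u = w := by
    rcases (Gᶜ.neighborFinset v).eq_empty_or_nonempty with h | ⟨w, hw⟩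
    · obtain ⟨w, hw⟩ := exists_ne v
      refine ⟨w, hw, fun u hu => ?_⟩
      simp [← SimpleGraph.mem_neighborFinset, h] at hu
    · refine ⟨w, ((Gᶜ.mem_neighborFinset _ _).1 hw).ne', fun u hu => ?_⟩
      exact card_le_one.1 hcard u ((Gᶜ.mem_neighborFinset _ _).2 hu) w hw
  let e₀ := (Fintype.equivFinOfCardEq hV).symm
  let e₁ := (Equiv.swap 0 (e₀.symm v)).trans e₀
  have he₁ : e₁ 0 = v := by simp [e₁]
  have h5 : e₁.symm w ≠ 0 := fun h => hwv (by rw [← he₁, ← h, Equiv.apply_symm_apply])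
  let f := (Equiv.swap 5 (e₁.symm w)).trans e₁
  have hf0 : f 0 = v := by
    simp [f, Equiv.swap_apply_of_ne_of_ne (show (0 : Fin 6) ≠ 5 by decide) h5.symm, he₁]
  have hf5 : f 5 = w := by simp [f]
  refine ⟨f, fun i hi0 hi5 => ?_⟩
  by_contra h
  refine hi5 (f.injective ?_)
  rw [hf5]
  refine hw _ ((G.compl_adj _ _).2 ⟨?_, hf0 ▸ h⟩)
  exact hf0 ▸ f.injective.ne hi0.symm

/-- Theorem 3.1.3 (case `n = 5`): a connected primitively log divergent simple graph
with exactly `10` edges is isomorphic to one of `WS₅`, `ZZ₅`, `ST₅`, `XX₅`. -/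
theorem primLogDivergent_ten_edges {V : Type*} [Fintype V]
    (G : SimpleGraph V) (hconn : G.Connected) (hpld : PrimLogDivergent G)
    (hcard : Nat.card G.edgeSet = 10) :
    Nonempty (G ≃g graphOfMatrix matWS5) ∨
    Nonempty (G ≃g graphOfMatrix matZZ5) ∨
    Nonempty (G ≃g graphOfMatrix matST5) ∨
    Nonempty (G ≃g graphOfMatrix matXX5) := by
  classical
  have hV : Fintype.card V = 6 := by
    have h := hpld.1
    rw [LogDivergent, betti, hconn.natCard_connectedComponent, hcard,
      Nat.card_eq_fintype_card] at h
    omega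
  have hE : #G.edgeFinset = 10 := by
    rw [← hcard, Nat.card_eq_fintype_card, G.edgeFinset_card]
  have hdeg := hpld.three_le_degree hconn hV hE
  have htot := G.sum_degrees_eq_twice_card_edges
  obtain ⟨v, hv⟩ : ∃ v, 4 ≤ G.degree v := by
    by_contra! h
    have := sum_le_card_nsmul univ (fun v => G.degree v) 3 fun v _ => Nat.le_of_lt_succ (h v)
    rw [card_univ, hV, htot, hE, smul_eq_mul] at this
    omega
  obtain ⟨f, hf⟩ := G.exists_equiv_adj_of_four_le_degree hV hv
  let A : Fin 6 → Fin 6 → Bool := fun i j => decide (G.Adj (f i) (f j))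
  have hrow (i : Fin 6) : G.degree (f i) = ∑ j, (A i j).toNat := by
    rw [← G.card_neighborFinset_eq_degree, G.neighborFinset_eq_filter, card_filter,
      ← f.sum_comp]
    simp [A, Bool.toNat, Bool.cond_decide]
  have hself (i : Fin 6) : A i i = false := by simp [A]
  have hsymm (i j : Fin 6) : A i j = A j i := by simp [A, G.adj_comm]
  obtain ⟨a1, a2, a3, a4⟩ : A 0 1 = true ∧ A 0 2 = true ∧ A 0 3 = true ∧ A 0 4 = true := by
    simp only [A, decide_eq_true_eq]
    refine ⟨hf _ ?_ ?_, hf _ ?_ ?_, hf _ ?_ ?_, hf _ ?_ ?_⟩ <;> decide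
  have hA : A = symmBoolMatrix true true true true (A 0 5) (A 1 2) (A 1 3) (A 1 4)
      (A 1 5) (A 2 3) (A 2 4) (A 2 5) (A 3 4) (A 3 5) (A 4 5) := by
    funext i j
    fin_cases i <;> fin_cases j <;>
      first | exact hself _ | rfl | assumption | exact hsymm _ _ | exact (hsymm _ _).trans ‹_›
  have hd (i : Fin 6) : 3 ≤ ∑ j, (A i j).toNat := hrow i ▸ hdeg (f i)
  rw [hE, ← f.sum_comp] at htot
  have h1 := hd 1
  have h2 := hd 2
  have h3 := hd 3
  have h4 := hd 4
  have h5 := hd 5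
  simp only [hrow, Fin.sum_univ_six, hself, hsymm 1 0, hsymm 2 0, hsymm 3 0, hsymm 4 0,
    hsymm 5 0, hsymm 2 1, hsymm 3 1, hsymm 4 1, hsymm 5 1, hsymm 3 2, hsymm 4 2, hsymm 5 2,
    hsymm 4 3, hsymm 5 3, hsymm 5 4, a1, a2, a3, a4, Bool.toNat_false, Bool.toNat_true, add_zero,
    zero_add] at h1 h2 h3 h4 h5 htot
  have h := isRelabelling_of_three_le_rowSum _ _ _ _ _ h1 _ _ _ h2 _ _ h3 _ h4 h5
    (by linarith)
  rw [← hA] at h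
  exact h.imp (nonempty_iso_of_isRelabelling f (by decide) (by decide)) <|
    Or.imp (nonempty_iso_of_isRelabelling f (by decide) (by decide)) <|
    Or.imp (nonempty_iso_of_isRelabelling f (by decide) (by decide))
      (nonempty_iso_of_isRelabelling f (by decide) (by decide))
end

section
/- Let Γ and Γ' be connected simple graphs on disjoint vertex sets, let uv ∈ E(Γ) be an edge such that Γ with the edge uv deleted is still connected, and let u'v' ∈ E(Γ') be an edge such that Γ' with the edge u'v' deleted is still connected. Then the gluing Γ×Γ' along uv and u'v' is connected, has |E(Γ)| + |E(Γ')| − 2 edges and |V(Γ)| + |V(Γ')| − 2 vertices, and h₁(Γ×Γ') = h₁(Γ) + h₁(Γ') − 1. In particular, if Γ and Γ' are both logarithmically divergent then so is Γ×Γ'. -/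
/-- The vertex identification map used in the gluing construction: `u' ↦ u`, `v' ↦ v`,
and every other vertex of `Γ'` is kept (as an element of the right summand). -/
def glueMap {V V' : Type*} [DecidableEq V'] (u v : V) (u' v' : V') (x : V') :
    V ⊕ {y : V' // y ≠ u' ∧ y ≠ v'} :=
  if h1 : x = u' then Sum.inl u
  else if h2 : x = v' then Sum.inl v
  else Sum.inr ⟨x, h1, h2⟩

/-- The gluing `Γ × Γ'` of two simple graphs (on disjoint vertex sets) along the edges
`uv` and `u'v'`: delete the edge `uv` from `Γ` and the edge `u'v'` from `Γ'`, take the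
disjoint union, and identify `u` with `u'` and `v` with `v'`. -/
def glue {V V' : Type*} [DecidableEq V'] (G : SimpleGraph V) (G' : SimpleGraph V')
    (u v : V) (u' v' : V') : SimpleGraph (V ⊕ {y : V' // y ≠ u' ∧ y ≠ v'}) :=
  SimpleGraph.fromEdgeSet
    ((Sym2.map Sum.inl '' (G.edgeSet \ {s(u, v)})) ∪
     (Sym2.map (glueMap u v u' v') '' (G'.edgeSet \ {s(u', v')})))

theorem not_isDiag_map_of_mem_edgeSet {W W' : Type*} {H : SimpleGraph W} {f : W → W'}
    (hf : Function.Injective f) {e : Sym2 W} (he : e ∈ H.edgeSet) :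
    ¬ (Sym2.map f e).IsDiag := by
  rw [Sym2.isDiag_map hf]
  exact H.not_isDiag_of_mem_edgeSet he

section Gluing

variable {V V' : Type*} [DecidableEq V'] {G : SimpleGraph V} {G' : SimpleGraph V'}
  {u v : V} {u' v' : V'}

theorem glueMap_injective (huv : u ≠ v) : Function.Injective (glueMap u v u' v') := by
  intro x y hxy
  unfold glueMap at hxy
  split_ifs at hxy <;> simp_all

theorem glueMap_eq_inl {x : V'} {a : V} (h : glueMap u v u' v' x = Sum.inl a) :
    x = u' ∨ x = v' := by
  unfold glueMap at h
  split_ifs at h <;> simp_all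

theorem glueMap_left : glueMap u v u' v' u' = Sum.inl u := by
  simp [glueMap]

theorem glueMap_of_ne (x : {y : V' // y ≠ u' ∧ y ≠ v'}) :
    glueMap u v u' v' x = Sum.inr x := by
  simp [glueMap, x.2.1, x.2.2]

theorem edgeSet_glue (huv : u ≠ v) :
    (glue G G' u v u' v').edgeSet =
      (Sym2.map Sum.inl '' (G.edgeSet \ {s(u, v)})) ∪
        (Sym2.map (glueMap u v u' v') '' (G'.edgeSet \ {s(u', v')})) := by
  rw [glue, SimpleGraph.edgeSet_fromEdgeSet, sdiff_eq_left, Set.disjoint_left]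
  rintro _ (⟨e, he, rfl⟩ | ⟨e, he, rfl⟩)
  · exact not_isDiag_map_of_mem_edgeSet Sum.inl_injective he.1
  · exact not_isDiag_map_of_mem_edgeSet (glueMap_injective huv) he.1

theorem disjoint_glue_edges :
    Disjoint (Sym2.map Sum.inl '' (G.edgeSet \ {s(u, v)}))
      (Sym2.map (glueMap u v u' v') '' (G'.edgeSet \ {s(u', v')})) := by
  rw [Set.disjoint_left]
  rintro _ ⟨e, -, rfl⟩ ⟨e', ⟨he', hne⟩, h⟩
  induction e with | _ a b
  induction e' with | _ x y
  have hxy : x ≠ y := G'.ne_of_adj he'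
  have hx : x = u' ∨ x = v' := by
    have : glueMap u v u' v' x ∈ Sym2.map Sum.inl s(a, b) := h ▸ by simp
    obtain ⟨c, -, hc⟩ := Sym2.mem_map.1 this
    exact glueMap_eq_inl hc.symm
  have hy : y = u' ∨ y = v' := by
    have : glueMap u v u' v' y ∈ Sym2.map Sum.inl s(a, b) := h ▸ by simp
    obtain ⟨c, -, hc⟩ := Sym2.mem_map.1 this
    exact glueMap_eq_inl hc.symm
  apply hne
  rcases hx with rfl | rfl <;> rcases hy with rfl | rfl <;> simp_all [Sym2.eq_swap]

theorem card_edgeSet_glue [Finite V] [Finite V'] (huv : u ≠ v)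
    (he : s(u, v) ∈ G.edgeSet) (he' : s(u', v') ∈ G'.edgeSet) :
    Nat.card (glue G G' u v u' v').edgeSet + 2
      = Nat.card G.edgeSet + Nat.card G'.edgeSet := by
  simp only [Nat.card_coe_set_eq]
  rw [edgeSet_glue huv, Set.ncard_union_eq disjoint_glue_edges,
    Set.ncard_image_of_injective _ (Sym2.map.injective Sum.inl_injective),
    Set.ncard_image_of_injective _ (Sym2.map.injective (glueMap_injective huv)),
    ← Set.ncard_sdiff_singleton_add_one he, ← Set.ncard_sdiff_singleton_add_one he']
  ring

theorem connected_glue (huv : u ≠ v) (hdel : (G.deleteEdges {s(u, v)}).Connected)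
    (hdel' : (G'.deleteEdges {s(u', v')}).Connected) :
    (glue G G' u v u' v').Connected := by
  let f : G.deleteEdges {s(u, v)} →g glue G G' u v u' v' :=
    ⟨Sum.inl, fun {a b} h => by
      rw [← SimpleGraph.mem_edgeSet, edgeSet_glue huv]
      rw [SimpleGraph.deleteEdges_adj] at h
      exact Or.inl ⟨s(a, b), h, rfl⟩⟩
  let g : G'.deleteEdges {s(u', v')} →g glue G G' u v u' v' :=
    ⟨glueMap u v u' v', fun {a b} h => by
      rw [← SimpleGraph.mem_edgeSet, edgeSet_glue huv]
      rw [SimpleGraph.deleteEdges_adj] at h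
      exact Or.inr ⟨s(a, b), h, rfl⟩⟩
  refine SimpleGraph.connected_iff_exists_forall_reachable _ |>.2 ⟨Sum.inl u, ?_⟩
  rintro (a | x)
  · exact (hdel.preconnected u a).map f
  · have h : (glue G G' u v u' v').Reachable (glueMap u v u' v' u') (glueMap u v u' v' x) :=
      (hdel'.preconnected u' x).map g
    rwa [glueMap_left, glueMap_of_ne] at h

end Gluing

theorem card_glue_vertices {V V' : Type*} {u' v' : V'} [Finite V] [Finite V'] (hne : u' ≠ v') :
    Nat.card (V ⊕ {y : V' // y ≠ u' ∧ y ≠ v'}) + 2 = Nat.card V + Nat.card V' := by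
  have hset : {y : V' | y ≠ u' ∧ y ≠ v'} = ({u', v'} : Set V')ᶜ := by
    ext y
    simp
  have hcard : Nat.card {y : V' // y ≠ u' ∧ y ≠ v'} = ({u', v'} : Set V')ᶜ.ncard := by
    rw [← hset]
    rfl
  rw [Nat.card_sum, hcard, ← Set.ncard_add_ncard_compl ({u', v'} : Set V'),
    Set.ncard_pair hne]
  ring

theorem betti_of_connected {V : Type*} {G : SimpleGraph V} (hG : G.Connected) :
    betti G = (Nat.card G.edgeSet : ℤ) - Nat.card V + 1 := by
  have := hG.preconnected.subsingleton_connectedComponent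
  have := hG.nonempty
  have : Nonempty G.ConnectedComponent := this.map G.connectedComponentMk
  rw [betti, Nat.card_of_subsingleton (Classical.arbitrary G.ConnectedComponent)]
  simp

/-- Let `Γ`, `Γ'` be connected simple graphs (on disjoint vertex sets), `uv ∈ E(Γ)`
with `Γ − uv` still connected and `u'v' ∈ E(Γ')` with `Γ' − u'v'` still connected.
Then the gluing `Γ × Γ'` is connected, has `|E(Γ)| + |E(Γ')| − 2` edges and
`|V(Γ)| + |V(Γ')| − 2` vertices, and `h₁(Γ × Γ') = h₁(Γ) + h₁(Γ') − 1`.  In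
particular, if `Γ` and `Γ'` are both logarithmically divergent then so is `Γ × Γ'`. -/
theorem glue_counts {V V' : Type*} [Fintype V] [Fintype V'] [DecidableEq V']
    (G : SimpleGraph V) (G' : SimpleGraph V')
    (hG : G.Connected) (hG' : G'.Connected)
    (u v : V) (u' v' : V')
    (he : s(u, v) ∈ G.edgeSet) (he' : s(u', v') ∈ G'.edgeSet)
    (hdel : (G.deleteEdges {s(u, v)}).Connected)
    (hdel' : (G'.deleteEdges {s(u', v')}).Connected) :
    (glue G G' u v u' v').Connected ∧
    Nat.card (glue G G' u v u' v').edgeSet + 2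
      = Nat.card G.edgeSet + Nat.card G'.edgeSet ∧
    Nat.card (V ⊕ {y : V' // y ≠ u' ∧ y ≠ v'}) + 2 = Nat.card V + Nat.card V' ∧
    betti (glue G G' u v u' v') + 1 = betti G + betti G' ∧
    (LogDivergent G → LogDivergent G' → LogDivergent (glue G G' u v u' v')) := by
  have huv : u ≠ v := G.ne_of_adj he
  have hconn := connected_glue huv hdel hdel'
  have hE := card_edgeSet_glue huv he he'
  have hV := card_glue_vertices (V := V) (G'.ne_of_adj he')
  refine ⟨hconn, hE, hV, ?_, ?_⟩
  · rw [betti_of_connected hconn, betti_of_connected hG, betti_of_connected hG']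
    lia
  · unfold LogDivergent
    rw [betti_of_connected hconn, betti_of_connected hG, betti_of_connected hG']
    lia
end
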